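/- arXiv:math/9906042 — 8 statements merged into one kernel-verified Lean document; each statement's English description precedes it below -/
import Mathlib

section
/- Digon case, large truncated area. For all real α ∈ [1/4, 1] and all real T ≥ 0.21, one has 2√(π·α) + T·12^(1/4) + (2 − 6)·0.0505 − 2α·12^(1/4) > 0. -/
open Real

/-- **Digon case, large truncated area.**
For `α ∈ [1/4, 1]` and `T ≥ 0.21`,
`2√(πα) + T·12^(1/4) + (2 − 6)·0.0505 − 2α·12^(1/4) > 0`. -/
theorem digon_large_truncated_area (α T : ℝ) (hα₁ : 1 / 4 ≤ α) (hα₂ : α ≤ 1)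
    (hT : 0.21 ≤ T) :
    2 * Real.sqrt (Real.pi * α) + T * (12 : ℝ) ^ ((1 : ℝ) / 4)
      + ((2 : ℝ) - 6) * 0.0505 - 2 * α * (12 : ℝ) ^ ((1 : ℝ) / 4) > 0 := by
  have hc_pos : (0 : ℝ) < (12 : ℝ) ^ ((1 : ℝ) / 4) := by positivity
  have hc_pow : ((12 : ℝ) ^ ((1 : ℝ) / 4)) ^ 4 = 12 := by
    rw [← Real.rpow_natCast, ← Real.rpow_mul (by norm_num)]
    norm_num
  set c : ℝ := (12 : ℝ) ^ ((1 : ℝ) / 4)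
  have hc : c ≤ 1.8613 :=
    le_of_pow_le_pow_left₀ (n := 4) (by norm_num) (by norm_num) (by rw [hc_pow]; norm_num)
  have hpi : 1.772 ≤ √π := Real.le_sqrt_of_sq_le (by linarith [Real.pi_gt_d4])
  have hs_low : 1 / 2 ≤ √α := Real.le_sqrt_of_sq_le (by linarith)
  have hs_high : √α ≤ 1 := Real.sqrt_le_one.mpr hα₂
  have hs_sq : √α ^ 2 = α := Real.sq_sqrt (by linarith)
  have hsqrt : 1.772 * √α ≤ √(π * α) := by
    rw [Real.sqrt_mul Real.pi_pos.le]
    gcongr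
  have hTc : 0.21 * c ≤ T * c := by gcongr
  have hαc : (2 * α - 0.21) * c ≤ (2 * α - 0.21) * 1.8613 :=
    mul_le_mul_of_nonneg_left hc (by linarith)
  have hchord : 0 ≤ (1 - √α) * (√α - 1 / 2) :=
    mul_nonneg (by linarith) (by linarith)
  nlinarith
end

section
/- Digon case after reflection. For all real α ∈ [1/4, 1] and all real T ∈ [0, 0.21], one has 2√(π·(α + 2·0.29)) + T·12^(1/4) + (2 − 6)·0.0505 − 2α·12^(1/4) > 0. -/
open Real

lemma rpow_twelve_quarter_lt : (12 : ℝ) ^ ((1 : ℝ) / 4) < 1.862 := by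
  refine lt_of_pow_lt_pow_left₀ 4 (by norm_num) ?_
  rw [← Real.rpow_natCast, ← Real.rpow_mul (by norm_num)]
  norm_num

/-- **Digon case after reflection.**
For `α ∈ [1/4, 1]` and `T ∈ [0, 0.21]`,
`2√(π(α + 2·0.29)) + T·12^(1/4) + (2 − 6)·0.0505 − 2α·12^(1/4) > 0`. -/
theorem digon_after_reflection (α T : ℝ) (hα₁ : 1 / 4 ≤ α) (hα₂ : α ≤ 1)
    (hT₁ : 0 ≤ T) (hT₂ : T ≤ 0.21) :
    2 * Real.sqrt (Real.pi * (α + 2 * 0.29)) + T * (12 : ℝ) ^ ((1 : ℝ) / 4)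
      + ((2 : ℝ) - 6) * 0.0505 - 2 * α * (12 : ℝ) ^ ((1 : ℝ) / 4) > 0 := by
  have hc := rpow_twelve_quarter_lt
  have hs : 0.101 + 1.862 * α < √(π * (α + 2 * 0.29)) := by
    apply Real.lt_sqrt_of_sq_lt
    nlinarith [Real.pi_gt_d2]
  have hTc : 0 ≤ T * (12 : ℝ) ^ ((1 : ℝ) / 4) := by positivity
  have hαc : α * (12 : ℝ) ^ ((1 : ℝ) / 4) ≤ α * 1.862 := by gcongr
  linarith
end

section
/- Case I, very negative truncated area. For every natural number N ≥ 3, every natural number k ≥ 1, and every real X_J ≤ −0.36 − k/2, one has k·√π − 2√π·X_J + (k/2 + X_J)·12^(1/4) + (N − 6)·0.0505 − 2·12^(1/4) > 0. -/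
open Real

/-- **Case I, very negative truncated area.**
For natural numbers `N ≥ 3`, `k ≥ 1`, and real `X_J ≤ −0.36 − k/2`,
`k√π − 2√π·X_J + (k/2 + X_J)·12^(1/4) + (N − 6)·0.0505 − 2·12^(1/4) > 0`. -/
theorem caseI_very_negative_truncated_area (N k : ℕ) (hN : 3 ≤ N) (hk : 1 ≤ k)
    (XJ : ℝ) (hXJ : XJ ≤ -0.36 - (k : ℝ) / 2) :
    (k : ℝ) * Real.sqrt Real.pi - 2 * Real.sqrt Real.pi * XJ
      + ((k : ℝ) / 2 + XJ) * (12 : ℝ) ^ ((1 : ℝ) / 4)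
      + ((N : ℝ) - 6) * 0.0505 - 2 * (12 : ℝ) ^ ((1 : ℝ) / 4) > 0 := by
  have hs : (1.77 : ℝ) < √π := by
    apply Real.lt_sqrt_of_sq_lt
    linarith [Real.pi_gt_d2]
  have hc : (12 : ℝ) ^ ((1 : ℝ) / 4) < 1.87 := by
    rw [one_div, Real.rpow_inv_lt_iff_of_pos (by norm_num) (by norm_num) (by norm_num)]
    norm_num
  have hN' : (3 : ℝ) ≤ N := by exact_mod_cast hN
  have hk' : (1 : ℝ) ≤ k := by exact_mod_cast hk
  set s := √π
  set c := (12 : ℝ) ^ ((1 : ℝ) / 4)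
  have hX : 0 ≤ (2 * s - c) * (-0.36 - (k : ℝ) / 2 - XJ) :=
    mul_nonneg (by linarith) (by linarith)
  have hks : 0 ≤ ((k : ℝ) - 1) * s := mul_nonneg (by linarith) (by linarith)
  linarith
end

section
/- Case I, intermediate truncated area. For every natural number N ≥ 3, every real α ∈ [0, 1], and every real T ∈ [−0.36, 0.177], one has 2√(π·(α + 2·0.323)) + T·12^(1/4) + (N − 6)·0.0505 − 2α·12^(1/4) > 0. -/
open Real

/-- **Case I, intermediate truncated area.**
For natural `N ≥ 3`, `α ∈ [0, 1]`, and `T ∈ [−0.36, 0.177]`,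
`2√(π(α + 2·0.323)) + T·12^(1/4) + (N − 6)·0.0505 − 2α·12^(1/4) > 0`. -/
theorem caseI_intermediate_truncated_area (N : ℕ) (hN : 3 ≤ N) (α T : ℝ)
    (hα₁ : 0 ≤ α) (hα₂ : α ≤ 1) (hT₁ : -0.36 ≤ T) (hT₂ : T ≤ 0.177) :
    2 * Real.sqrt (Real.pi * (α + 2 * 0.323)) + T * (12 : ℝ) ^ ((1 : ℝ) / 4)
      + ((N : ℝ) - 6) * 0.0505 - 2 * α * (12 : ℝ) ^ ((1 : ℝ) / 4) > 0 := by
  have hc : (12 : ℝ) ^ ((1 : ℝ) / 4) ≤ 1.8613 := by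
    calc (12 : ℝ) ^ ((1 : ℝ) / 4) ≤ ((1.8613 : ℝ) ^ (4 : ℝ)) ^ ((1 : ℝ) / 4) := by
          gcongr
          norm_num
      _ = 1.8613 := by
          rw [← Real.rpow_mul (by norm_num)]
          norm_num
  have hc₀ : 0 ≤ (12 : ℝ) ^ ((1 : ℝ) / 4) := by positivity
  have hchord : 1.42 + 0.8535 * α ≤ Real.sqrt (Real.pi * (α + 2 * 0.323)) := by
    apply Real.le_sqrt_of_sq_le
    have hpi : 3.1415 * (α + 2 * 0.323) ≤ Real.pi * (α + 2 * 0.323) :=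
      mul_le_mul_of_nonneg_right Real.pi_gt_d4.le (by linarith)
    nlinarith [mul_nonneg hα₁ (sub_nonneg.2 hα₂)]
  have hN' : (3 : ℝ) ≤ N := by exact_mod_cast hN
  nlinarith [mul_nonneg (by linarith : 0 ≤ T + 0.36) hc₀,
    mul_nonneg (by linarith : 0 ≤ 2 * α + 0.36) (sub_nonneg.2 hc)]
end

section
/- Case II, small area, nonnegative truncation. For every natural number N ≥ 4 and every real α with 2π√3/(3N²) ≤ α ≤ 1/4, one has 2√(π·α) + (N − 6)·0.0505 − 2α·12^(1/4) > 0. -/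
open Real

theorem twelve_rpow_quarter_le : (12 : ℝ) ^ ((1 : ℝ) / 4) ≤ 1.9 := by
  refine (Real.rpow_le_rpow (by norm_num) (by norm_num : (12 : ℝ) ≤ 1.9 ^ 4)
    (by norm_num : (0 : ℝ) ≤ 1 / 4)).trans_eq ?_
  rw [← Real.rpow_natCast, ← Real.rpow_mul (by norm_num)]
  norm_num

theorem mul_le_sqrt_pi_mul {α : ℝ} (h₀ : 0 ≤ α) (h₁ : α ≤ 1 / 4) :
    3.4 * α ≤ √(π * α) := by
  apply Real.le_sqrt_of_sq_le
  nlinarith [mul_le_mul_of_nonneg_right Real.pi_gt_three.le h₀, mul_nonneg h₀ (sub_nonneg.2 h₁)]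

/-- **Case II, small area, nonnegative truncation.**
For natural `N ≥ 4` and `2π√3/(3N²) ≤ α ≤ 1/4`,
`2√(πα) + (N − 6)·0.0505 − 2α·12^(1/4) > 0`. -/
theorem caseII_small_area_nonneg_truncation (N : ℕ) (hN : 4 ≤ N) (α : ℝ)
    (hα₁ : 2 * Real.pi * Real.sqrt 3 / (3 * (N : ℝ) ^ 2) ≤ α) (hα₂ : α ≤ 1 / 4) :
    2 * Real.sqrt (Real.pi * α) + ((N : ℝ) - 6) * 0.0505
      - 2 * α * (12 : ℝ) ^ ((1 : ℝ) / 4) > 0 := by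
  have hN' : (4 : ℝ) ≤ N := by exact_mod_cast hN
  have hα : 0 < α := lt_of_lt_of_le (by positivity) hα₁
  have key : 0 < 3 * α + ((N : ℝ) - 6) * 0.0505 := by
    rcases le_or_gt 6 N with h | h
    · have h' : (6 : ℝ) ≤ N := by exact_mod_cast h
      linarith
    · have h' : (N : ℝ) ≤ 5 := by exact_mod_cast Nat.lt_succ_iff.1 h
      have h3 : (1.5 : ℝ) ≤ √3 := Real.le_sqrt_of_sq_le (by norm_num)
      rw [div_le_iff₀ (by positivity)] at hα₁
      nlinarith [mul_le_mul Real.pi_gt_three.le h3 (by norm_num) Real.pi_pos.le,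
        mul_le_mul_of_nonneg_left (pow_le_pow_left₀ (by positivity) h' 2) hα.le]
  linarith [mul_le_sqrt_pi_mul hα.le hα₂, mul_le_mul_of_nonneg_left twelve_rpow_quarter_le hα.le]
end

section
/- Linear bound for p. Define p(t) = (t − sin t · cos t)/sin²t for t ≠ 0. Then for every real θ with 0 < θ ≤ 0.5, one has p(θ) ≤ 0.87·θ. -/
open Real

/-- **Linear bound for `p`.** With `p(t) = (t − sin t cos t)/sin² t`,
for `0 < θ ≤ 0.5` one has `p(θ) ≤ 0.87·θ`. -/
theorem p_linear_bound (θ : ℝ) (hθ₁ : 0 < θ) (hθ₂ : θ ≤ 0.5) :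
    (θ - Real.sin θ * Real.cos θ) / Real.sin θ ^ 2 ≤ 0.87 * θ := by
  norm_num at hθ₂
  have hdouble : 2 * θ - (2 * θ) ^ 3 / 6 < 2 * sin θ * cos θ := by
    simpa only [sin_two_mul] using sin_gt_sub_cube (x := 2 * θ) (by positivity)
  have hsin : 23 / 24 * θ ≤ sin θ := by
    have hsq : θ ^ 2 ≤ 1 / 4 := by nlinarith
    nlinarith [sin_gt_sub_cube hθ₁, mul_le_mul_of_nonneg_left hsq hθ₁.le]
  have hsin_sq : (23 / 24 * θ) ^ 2 ≤ sin θ ^ 2 := by gcongr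
  have hsin_pos : 0 < sin θ := lt_of_lt_of_le (by positivity) hsin
  rw [div_le_iff₀ (by positivity)]
  nlinarith [mul_le_mul_of_nonneg_left hsin_sq hθ₁.le, pow_pos hθ₁ 3]
end

section
/- Polynomial positivity in the tight case. Let c = 4 / (6 · 0.87² · 1.06 · √12). Then for every real X with |X| ≤ 0.06, one has 2·(1 + c·X²)·(1 − X/2 − 0.22·X²) − 2 + X ≥ 0, with equality if and only if X = 0. -/
open Real

theorem tight_case_coefficient_lower_bound :
    (0.23 : ℝ) ≤ 4 / (6 * 0.87 ^ 2 * 1.06 * Real.sqrt 12) := by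
  have hs : Real.sqrt 12 ≤ 3.5 := Real.sqrt_le_iff.mpr (by norm_num)
  rw [le_div_iff₀ (by positivity)]
  linarith

theorem tight_case_quadratic_pos {c X : ℝ} (hc : 0.23 ≤ c) (hX : |X| ≤ 0.06) :
    0 < 2 * c * (1 - X / 2 - 0.22 * X ^ 2) - 0.44 := by
  obtain ⟨h₁, h₂⟩ := abs_le.mp hX
  have hq : 0.969 ≤ 1 - X / 2 - 0.22 * X ^ 2 := by nlinarith
  nlinarith

/-- **Polynomial positivity in the tight case.**
With `c = 4/(6·0.87²·1.06·√12)`, for every `|X| ≤ 0.06` one has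
`2(1 + cX²)(1 − X/2 − 0.22X²) − 2 + X ≥ 0`, with equality iff `X = 0`. -/
theorem tight_case_polynomial_positivity (c : ℝ)
    (hc : c = 4 / (6 * 0.87 ^ 2 * 1.06 * Real.sqrt 12)) (X : ℝ) (hX : |X| ≤ 0.06) :
    2 * (1 + c * X ^ 2) * (1 - X / 2 - 0.22 * X ^ 2) - 2 + X ≥ 0 ∧
      (2 * (1 + c * X ^ 2) * (1 - X / 2 - 0.22 * X ^ 2) - 2 + X = 0 ↔ X = 0) := by
  have hq := tight_case_quadratic_pos (hc ▸ tight_case_coefficient_lower_bound) hX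
  have hfactor : 2 * (1 + c * X ^ 2) * (1 - X / 2 - 0.22 * X ^ 2) - 2 + X =
      X ^ 2 * (2 * c * (1 - X / 2 - 0.22 * X ^ 2) - 0.44) := by ring
  rw [hfactor]
  exact ⟨by positivity, by simp [hq.ne']⟩
end

section
/- Derivative of the two-bump area function (Lemma A.5). Define p(t) = (t − sin t cos t)/sin²t and q(t) = t/sin t. Let I ⊆ ℝ be an open interval and let v, θ_u, θ_v : I → ℝ be differentiable functions such that for all u ∈ I: u > 0, v(u) > 0, θ_u(u) ∈ (0, π), θ_v(u) ∈ (0, π), u + v(u) is constant on I, u·q(θ_u(u)) + v(u)·q(θ_v(u)) is constant on I, and u·sin(θ_v(u)) = v(u)·sin(θ_u(u)). Define ρ(u) = u/(2·sin(θ_u(u))) and ξ(u) = (u²·p(θ_u(u)) + v(u)²·p(θ_v(u)))/4. Then for all u ∈ I at which the implicit system is nondegenerate, ξ′(u) = ρ(u)·(cos(θ_v(u)) − cos(θ_u(u))). In particular ξ′(u) ≥ 0 whenever θ_v(u) ≤ θ_u(u). -/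
open Real Set

/-- `p(t) = (t − sin t cos t)/sin² t`. -/
noncomputable def bumpP (t : ℝ) : ℝ := (t - Real.sin t * Real.cos t) / Real.sin t ^ 2

/-- `q(t) = t / sin t`. -/
noncomputable def bumpQ (t : ℝ) : ℝ := t / Real.sin t

/-- `q'(t) = (sin t − t cos t)/sin² t`, the derivative of `q`. -/
noncomputable def bumpQ' (t : ℝ) : ℝ := (Real.sin t - t * Real.cos t) / Real.sin t ^ 2

theorem hasDerivAt_bumpP {t : ℝ} (ht : Real.sin t ≠ 0) :
    HasDerivAt bumpP (2 * bumpQ' t / Real.sin t) t := by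
  have h := ((hasDerivAt_id t).sub ((Real.hasDerivAt_sin t).mul (Real.hasDerivAt_cos t))).div
    ((Real.hasDerivAt_sin t).pow 2) (pow_ne_zero 2 ht)
  refine h.congr_deriv ?_
  simp only [bumpQ', id, Pi.sub_apply, Pi.mul_apply, Pi.pow_apply]
  have hs := Real.sin_sq_add_cos_sq t
  field_simp
  norm_num
  linear_combination Real.sin t ^ 2 * hs

theorem hasDerivAt_bumpQ {t : ℝ} (ht : Real.sin t ≠ 0) : HasDerivAt bumpQ (bumpQ' t) t := by
  refine ((hasDerivAt_id t).div (Real.hasDerivAt_sin t) ht).congr_deriv ?_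
  simp [bumpQ']

/-- The arc length `w·q(θ)` of a bump with chord `w` and half-angle `θ`. -/
theorem HasDerivAt.mul_bumpQ {w θ : ℝ → ℝ} {w' θ' x : ℝ} (hw : HasDerivAt w w' x)
    (hθ : HasDerivAt θ θ' x) (hs : Real.sin (θ x) ≠ 0) :
    HasDerivAt (fun y => w y * bumpQ (θ y))
      (w' * bumpQ (θ x) + w x * (bumpQ' (θ x) * θ')) x :=
  hw.mul ((hasDerivAt_bumpQ hs).comp x hθ)

/-- First variation of the area of a bump: `dArea = r·(dLength − cos θ·dw)`, where
`r = w/(2 sin θ)` is the radius of the arc. -/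
theorem HasDerivAt.sq_mul_bumpP_div_four {w θ : ℝ → ℝ} {w' θ' x : ℝ} (hw : HasDerivAt w w' x)
    (hθ : HasDerivAt θ θ' x) (hs : Real.sin (θ x) ≠ 0) :
    HasDerivAt (fun y => w y ^ 2 * bumpP (θ y) / 4)
      (w x / (2 * Real.sin (θ x)) *
        (w' * bumpQ (θ x) + w x * (bumpQ' (θ x) * θ') - Real.cos (θ x) * w')) x := by
  have h := ((hw.pow 2).mul ((hasDerivAt_bumpP hs).comp x hθ)).div_const 4
  refine h.congr_deriv ?_
  simp only [bumpP, bumpQ, Function.comp_apply, Pi.pow_apply]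
  field_simp
  norm_num
  ring

/-- **Derivative of the two-bump area function (Lemma A.5).**
Two chords of lengths `u` and `v(u)` carry circular arcs subtending half-angles
`θ_u(u)`, `θ_v(u)` of common radius `ρ(u) = u/(2 sin θ_u(u))` (the equal-curvature
condition `u sin θ_v = v sin θ_u`).  If the total chord length `u + v(u)` and the
total arc length `u·q(θ_u(u)) + v(u)·q(θ_v(u))` are constant in `u`, then the total
enclosed area `ξ(u) = (u²·p(θ_u(u)) + v(u)²·p(θ_v(u)))/4` satisfies
`ξ′(u) = ρ(u)·(cos θ_v(u) − cos θ_u(u))` at every nondegenerate point of the implicit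
system; in particular `ξ′(u) ≥ 0` whenever `θ_v(u) ≤ θ_u(u)`. -/
theorem two_bump_area_derivative (a b : ℝ) (I : Set ℝ) (hI : I = Set.Ioo a b)
    (v θu θv : ℝ → ℝ)
    (hv : ∀ u ∈ I, DifferentiableAt ℝ v u)
    (hθu : ∀ u ∈ I, DifferentiableAt ℝ θu u)
    (hθv : ∀ u ∈ I, DifferentiableAt ℝ θv u)
    (hupos : ∀ u ∈ I, 0 < u)
    (hvpos : ∀ u ∈ I, 0 < v u)
    (hθu_mem : ∀ u ∈ I, θu u ∈ Set.Ioo 0 Real.pi)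
    (hθv_mem : ∀ u ∈ I, θv u ∈ Set.Ioo 0 Real.pi)
    (hchord : ∃ c, ∀ u ∈ I, u + v u = c)
    (harc : ∃ c, ∀ u ∈ I, u * bumpQ (θu u) + v u * bumpQ (θv u) = c)
    (hcurv : ∀ u ∈ I, u * Real.sin (θv u) = v u * Real.sin (θu u))
    (ρ : ℝ → ℝ) (hρ : ρ = fun u => u / (2 * Real.sin (θu u)))
    (ξ : ℝ → ℝ)
    (hξ : ξ = fun u => (u ^ 2 * bumpP (θu u) + (v u) ^ 2 * bumpP (θv u)) / 4)
    (u : ℝ) (hu : u ∈ I)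
    -- nondegeneracy of the differentiated implicit system at `u`
    (hnd : u ^ 2 * bumpQ' (θu u) * Real.cos (θv u)
        + (v u) ^ 2 * bumpQ' (θv u) * Real.cos (θu u) ≠ 0) :
    deriv ξ u = ρ u * (Real.cos (θv u) - Real.cos (θu u)) ∧
      (θv u ≤ θu u → 0 ≤ deriv ξ u) := by
  subst hI
  obtain ⟨c, hc⟩ := hchord
  obtain ⟨l, hl⟩ := harc
  have hnhds : Set.Ioo a b ∈ nhds u := Ioo_mem_nhds hu.1 hu.2
  have hsu : 0 < Real.sin (θu u) := Real.sin_pos_of_mem_Ioo (hθu_mem u hu)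
  have hsv : 0 < Real.sin (θv u) := Real.sin_pos_of_mem_Ioo (hθv_mem u hu)
  have du := hasDerivAt_id' u
  have dv := (hv u hu).hasDerivAt
  have dθu := (hθu u hu).hasDerivAt
  have dθv := (hθv u hu).hasDerivAt
  have hchord' : 1 + deriv v u = 0 :=
    (du.add dv).unique ((hasDerivAt_const u c).congr_of_eventuallyEq
      (Filter.eventually_of_mem hnhds hc))
  have harc' := ((du.mul_bumpQ dθu hsu.ne').add (dv.mul_bumpQ dθv hsv.ne')).unique
    ((hasDerivAt_const u l).congr_of_eventuallyEq (Filter.eventually_of_mem hnhds hl))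
  have hradius : v u / (2 * Real.sin (θv u)) = u / (2 * Real.sin (θu u)) := by
    rw [div_eq_div_iff (by positivity) (by positivity)]
    linear_combination -2 * hcurv u hu
  have hξ' : deriv ξ u = ρ u * (Real.cos (θv u) - Real.cos (θu u)) := by
    have h := (du.sq_mul_bumpP_div_four dθu hsu.ne').add
      (dv.sq_mul_bumpP_div_four dθv hsv.ne')
    rw [hradius] at h
    have hsum : ξ = (fun y => y ^ 2 * bumpP (θu y) / 4) +
        fun y => v y ^ 2 * bumpP (θv y) / 4 := by
      rw [hξ]
      ext y
      simp only [Pi.add_apply]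
      ring
    rw [hsum, h.deriv, hρ]
    linear_combination (u / (2 * Real.sin (θu u))) * harc' -
      (u / (2 * Real.sin (θu u))) * Real.cos (θv u) * hchord'
  refine ⟨hξ', fun hle => ?_⟩
  have hcos : Real.cos (θu u) ≤ Real.cos (θv u) :=
    Real.cos_le_cos_of_nonneg_of_le_pi (hθv_mem u hu).1.le (hθu_mem u hu).2.le hle
  have hu0 := hupos u hu
  rw [hξ', hρ]
  exact mul_nonneg (by positivity) (sub_nonneg.2 hcos)
end
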